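/- For every integer n with 24 ≤ n ≤ 52, there exist a real number α > 0, a real number M > 0, and two distinct triples of positive reals (m_0, m_1, m_2) ≠ (m_0', m_1', m_2') such that both triples satisfy the three equations (A): 1 = m_0 + m_1 H_n + 2m_2/(1+α²)^{3/2}, (B): α³ = m_0 + n α³ m_1/(1+α²)^{3/2} + m_2/4, and (C): M = m_0 + n m_1 + 2m_2 (with the same α and the same M). -/

import Mathlib

open Real Finset

/-- `H n = ∑_{j=1}^{n-1} 1/(4 sin(π j / n))`. -/
noncomputable def Hfun (n : ℕ) : ℝ :=
  ∑ j ∈ Finset.Ico 1 n, 1 / (4 * Real.sin (π * j / n))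

theorem nonneg_of_deriv_nonneg_of_zero {f f' : ℝ → ℝ} (hf : ∀ x, HasDerivAt f (f' x) x)
    (h0 : f 0 = 0) (hf' : ∀ x, 0 ≤ x → 0 ≤ f' x) {x : ℝ} (hx : 0 ≤ x) : 0 ≤ f x := by
  have hmono : MonotoneOn f (Set.Ici 0) := by
    refine monotoneOn_of_deriv_nonneg (convex_Ici 0)
      (fun y _ => (hf y).continuousAt.continuousWithinAt)
      (fun y _ => (hf y).differentiableAt.differentiableWithinAt) fun y hy => ?_
    rw [(hf y).deriv]
    exact hf' y (interior_subset hy)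
  simpa [h0] using hmono Set.self_mem_Ici hx hx

theorem sub_cube_le_sin {x : ℝ} (hx : 0 ≤ x) : x - x ^ 3 / 6 ≤ sin x := by
  have h := nonneg_of_deriv_nonneg_of_zero (f := fun y => sin y - (y - y ^ 3 / 6))
    (f' := fun y => cos y - (1 - y ^ 2 / 2))
    (fun y => by
      refine HasDerivAt.congr_deriv
        ((hasDerivAt_sin y).sub ((hasDerivAt_id y).sub ((hasDerivAt_pow 3 y).div_const 6)))
        ?_
      norm_num; ring)
    (by simp) (fun y _ => by linarith [one_sub_sq_div_two_le_cos (x := y)]) hx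
  simpa using h

theorem cos_le_quartic {x : ℝ} (hx : 0 ≤ x) : cos x ≤ 1 - x ^ 2 / 2 + x ^ 4 / 24 := by
  have h := nonneg_of_deriv_nonneg_of_zero (f := fun y => (1 - y ^ 2 / 2 + y ^ 4 / 24) - cos y)
    (f' := fun y => sin y - (y - y ^ 3 / 6))
    (fun y => by
      refine HasDerivAt.congr_deriv
        (((((hasDerivAt_pow 2 y).div_const 2).const_sub 1).add
          ((hasDerivAt_pow 4 y).div_const 24)).sub (hasDerivAt_cos y)) ?_
      norm_num; ring)
    (by simp) (fun y hy => by linarith [sub_cube_le_sin hy]) hx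
  simpa using h

theorem sin_le_quintic {x : ℝ} (hx : 0 ≤ x) : sin x ≤ x - x ^ 3 / 6 + x ^ 5 / 120 := by
  have h := nonneg_of_deriv_nonneg_of_zero (f := fun y => (y - y ^ 3 / 6 + y ^ 5 / 120) - sin y)
    (f' := fun y => (1 - y ^ 2 / 2 + y ^ 4 / 24) - cos y)
    (fun y => by
      refine HasDerivAt.congr_deriv
        ((((hasDerivAt_id y).sub ((hasDerivAt_pow 3 y).div_const 6)).add
            ((hasDerivAt_pow 5 y).div_const 120)).sub (hasDerivAt_sin y)) ?_
      norm_num; ring)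
    (by simp) (fun y hy => by linarith [cos_le_quartic hy]) hx
  simpa using h

theorem sextic_le_cos {x : ℝ} (hx : 0 ≤ x) :
    1 - x ^ 2 / 2 + x ^ 4 / 24 - x ^ 6 / 720 ≤ cos x := by
  have h := nonneg_of_deriv_nonneg_of_zero
    (f := fun y => cos y - (1 - y ^ 2 / 2 + y ^ 4 / 24 - y ^ 6 / 720))
    (f' := fun y => (y - y ^ 3 / 6 + y ^ 5 / 120) - sin y)
    (fun y => by
      refine HasDerivAt.congr_deriv
        ((hasDerivAt_cos y).sub (((((hasDerivAt_pow 2 y).div_const 2).const_sub 1).add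
          ((hasDerivAt_pow 4 y).div_const 24)).sub ((hasDerivAt_pow 6 y).div_const 720))) ?_
      norm_num; ring)
    (by simp) (fun y hy => by linarith [sin_le_quintic hy]) hx
  simpa using h

theorem septic_le_sin {x : ℝ} (hx : 0 ≤ x) :
    x - x ^ 3 / 6 + x ^ 5 / 120 - x ^ 7 / 5040 ≤ sin x := by
  have h := nonneg_of_deriv_nonneg_of_zero
    (f := fun y => sin y - (y - y ^ 3 / 6 + y ^ 5 / 120 - y ^ 7 / 5040))
    (f' := fun y => cos y - (1 - y ^ 2 / 2 + y ^ 4 / 24 - y ^ 6 / 720))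
    (fun y => by
      refine HasDerivAt.congr_deriv
        ((hasDerivAt_sin y).sub
          ((((hasDerivAt_id y).sub ((hasDerivAt_pow 3 y).div_const 6)).add
            ((hasDerivAt_pow 5 y).div_const 120)).sub ((hasDerivAt_pow 7 y).div_const 5040))) ?_
      norm_num; ring)
    (by simp) (fun y hy => by linarith [sextic_le_cos hy]) hx
  simpa using h

/-- `10 ^ 6` times a lower bound for `1 / (4 sin (π m / n))`, `0 < m ≤ n / 2`. -/
def quarterCscLower (m n : ℕ) : ℕ :=
  let a := 31415 * m
  let d := 10000 * n
  10 ^ 6 * (600000 * d ^ 5) /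
    (20000 * (120 * a * d ^ 4 + a ^ 5 - 20 * a ^ 3 * d ^ 2) + 120 * d ^ 5)

/-- `10 ^ 6` times an upper bound for `1 / (4 sin (π m / n))`, `0 < m ≤ n / 2`. -/
def quarterCscUpper (m n : ℕ) : ℕ :=
  let a := 31415 * m
  let d := 10000 * n
  10 ^ 6 * (1260 * d ^ 7) /
    (5040 * a * d ^ 6 + 42 * a ^ 5 * d ^ 2 - (840 * a ^ 3 * d ^ 4 + a ^ 7)) + 1

theorem sum_quarterCsc_bounds : ∀ n ∈ Finset.Icc 24 52,
    522500 * n < ∑ j ∈ Finset.Ico 1 n, quarterCscLower (min j (n - j)) n ∧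
      ∑ j ∈ Finset.Ico 1 n, quarterCscUpper (min j (n - j)) n < 649500 * n := by
  decide +kernel

theorem septic_le_sin_pi_mul {t : ℝ} (h0 : 0 ≤ t) (h1 : t ≤ 1 / 2) :
    let x := 31415 / 10000 * t
    x - x ^ 3 / 6 + x ^ 5 / 120 - x ^ 7 / 5040 ≤ sin (π * t) := by
  have hx : 0 ≤ 31415 / 10000 * t := by positivity
  refine (septic_le_sin hx).trans (sin_le_sin_of_le_of_le_pi_div_two ?_ ?_ ?_)
  · linarith [pi_pos]
  · nlinarith [pi_pos]
  · exact mul_le_mul_of_nonneg_right (by linarith [pi_gt_d6]) h0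

theorem sin_pi_mul_le_quintic {t : ℝ} (h0 : 0 ≤ t) (h1 : t ≤ 1 / 2) :
    let x := 31415 / 10000 * t
    sin (π * t) ≤ x - x ^ 3 / 6 + x ^ 5 / 120 + 1 / 20000 := by
  have hle : 31415 / 10000 * t ≤ π * t :=
    mul_le_mul_of_nonneg_right (by linarith [pi_gt_d6]) h0
  have hdist : π * t - 31415 / 10000 * t ≤ 1 / 20000 := by
    nlinarith [pi_lt_d6, pi_gt_d6]
  have hlip := (le_abs_self _).trans (abs_sin_sub_sin_le (π * t) (31415 / 10000 * t))
  rw [abs_of_nonneg (sub_nonneg.2 hle)] at hlip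
  have hq := sin_le_quintic (x := 31415 / 10000 * t) (by positivity)
  simp only
  linarith

theorem sin_pi_mul_div_pos {m n : ℕ} (hm : 0 < m) (hmn : 2 * m ≤ n) : 0 < sin (π * (m / n)) := by
  have hn : (0 : ℝ) < n := by exact_mod_cast (by omega : 0 < n)
  have hm' : (m : ℝ) < n := by exact_mod_cast (by omega : m < n)
  refine sin_pos_of_pos_of_lt_pi (by positivity) ?_
  exact mul_lt_of_lt_one_right pi_pos ((div_lt_one hn).2 hm')

theorem cast_div_le_half {m n : ℕ} (hm : 0 < m) (hmn : 2 * m ≤ n) : (m : ℝ) / n ≤ 1 / 2 := by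
  have hn : (0 : ℝ) < n := by exact_mod_cast (by omega : 0 < n)
  have : (2 : ℝ) * m ≤ n := by exact_mod_cast hmn
  rw [div_le_iff₀ hn]
  linarith

theorem quarterCscLower_le {m n : ℕ} (hm : 0 < m) (hmn : 2 * m ≤ n) :
    (quarterCscLower m n : ℝ) / 10 ^ 6 ≤ 1 / (4 * sin (π * (m / n))) := by
  have hs := sin_pi_mul_div_pos hm hmn
  have h := sin_pi_mul_le_quintic (by positivity) (cast_div_le_half hm hmn)
  simp only at h
  rw [show (31415 / 10000 * ((m : ℝ) / n)) = (31415 * m : ℕ) / (10000 * n : ℕ) by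
    push_cast; ring] at h
  have hd : 0 < 10000 * n := by omega
  simp only [quarterCscLower]
  generalize 31415 * m = a at *
  generalize 10000 * n = d at *
  have hd' : (0 : ℝ) < d := by exact_mod_cast hd
  have hsub : 20 * a ^ 3 * d ^ 2 ≤ 120 * a * d ^ 4 + a ^ 5 := by
    have : (20 : ℝ) * a ^ 3 * d ^ 2 ≤ 120 * a * d ^ 4 + a ^ 5 := by
      have h1 : (0 : ℝ) ≤ a * (a ^ 2 - 10 * d ^ 2) ^ 2 := by positivity
      have h2 : (0 : ℝ) ≤ 20 * (a * d ^ 4) := by positivity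
      linarith
    exact_mod_cast this
  refine (div_le_div_of_nonneg_right Nat.cast_div_le (by positivity)).trans ?_
  push_cast [Nat.cast_sub hsub]
  have hpos : (0 : ℝ) < a / d - (a / d) ^ 3 / 6 + (a / d) ^ 5 / 120 + 1 / 20000 := hs.trans_le h
  have heq : 20000 * (120 * a * d ^ 4 + a ^ 5 - 20 * a ^ 3 * d ^ 2) + 120 * (d : ℝ) ^ 5 =
      2400000 * d ^ 5 * (a / d - (a / d) ^ 3 / 6 + (a / d) ^ 5 / 120 + 1 / 20000) := by
    field_simp
    ring
  rw [heq]
  refine le_trans (le_of_eq ?_) (one_div_le_one_div_of_le (by positivity)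
    (mul_le_mul_of_nonneg_left h (by norm_num)))
  generalize (a / d - (a / d) ^ 3 / 6 + (a / d) ^ 5 / 120 + 1 / 20000 : ℝ) = q at hpos
  field_simp
  norm_num

theorem le_quarterCscUpper {m n : ℕ} (hm : 0 < m) (hmn : 2 * m ≤ n) :
    1 / (4 * sin (π * (m / n))) ≤ (quarterCscUpper m n : ℝ) / 10 ^ 6 := by
  have ht := cast_div_le_half hm hmn
  have h := septic_le_sin_pi_mul (by positivity) ht
  simp only at h
  have hx2 : 31415 / 10000 * ((m : ℝ) / n) ≤ 2 := by linarith
  rw [show (31415 / 10000 * ((m : ℝ) / n)) = (31415 * m : ℕ) / (10000 * n : ℕ) by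
    push_cast; ring] at h hx2
  have hd : 0 < 10000 * n := by omega
  have ha : 0 < 31415 * m := by omega
  simp only [quarterCscUpper]
  generalize 31415 * m = a at *
  generalize 10000 * n = d at *
  have hd' : (0 : ℝ) < d := by exact_mod_cast hd
  have ha' : (0 : ℝ) < a := by exact_mod_cast ha
  have hpos : (0 : ℝ) < a / d - (a / d) ^ 3 / 6 + (a / d) ^ 5 / 120 - (a / d) ^ 7 / 5040 := by
    have hx0 : (0 : ℝ) < a / d := by positivity
    generalize (a / d : ℝ) = x at hx0 hx2
    have hxx : x ^ 2 ≤ 4 := by nlinarith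
    rw [show x - x ^ 3 / 6 + x ^ 5 / 120 - x ^ 7 / 5040 =
      x * ((1 - x ^ 2 / 6) + x ^ 4 / 5040 * (42 - x ^ 2)) by ring]
    refine mul_pos hx0 (add_pos_of_pos_of_nonneg (by linarith) ?_)
    exact mul_nonneg (by positivity) (by linarith)
  have heq : 5040 * a * d ^ 6 + 42 * a ^ 5 * d ^ 2 - (840 * a ^ 3 * d ^ 4 + (a : ℝ) ^ 7) =
      5040 * d ^ 7 * (a / d - (a / d) ^ 3 / 6 + (a / d) ^ 5 / 120 - (a / d) ^ 7 / 5040) := by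
    field_simp
    ring
  have hlt : 840 * a ^ 3 * d ^ 4 + a ^ 7 < 5040 * a * d ^ 6 + 42 * a ^ 5 * d ^ 2 := by
    have : (840 : ℝ) * a ^ 3 * d ^ 4 + a ^ 7 < 5040 * a * d ^ 6 + 42 * a ^ 5 * d ^ 2 := by
      rw [← sub_pos, heq]
      positivity
    exact_mod_cast this
  have hdiv := Nat.lt_mul_div_succ (10 ^ 6 * (1260 * d ^ 7)) (Nat.sub_pos_of_lt hlt)
  generalize 10 ^ 6 * (1260 * d ^ 7) /
    (5040 * a * d ^ 6 + 42 * a ^ 5 * d ^ 2 - (840 * a ^ 3 * d ^ 4 + a ^ 7)) = k at hdiv ⊢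
  rw [← Nat.cast_lt (α := ℝ)] at hdiv
  push_cast [Nat.cast_sub hlt.le] at hdiv ⊢
  rw [heq] at hdiv
  refine (one_div_le_one_div_of_le (by positivity)
    (mul_le_mul_of_nonneg_left h (by norm_num))).trans ?_
  generalize (a / d - (a / d) ^ 3 / 6 + (a / d) ^ 5 / 120 - (a / d) ^ 7 / 5040 : ℝ) = q
    at hpos hdiv
  rw [div_le_div_iff₀ (by positivity) (by positivity)]
  refine le_of_mul_le_mul_left ?_ (by positivity : (0 : ℝ) < 1260 * d ^ 7)
  linarith

theorem sin_pi_mul_div_eq_min {n j : ℕ} (hj : j ∈ Finset.Ico 1 n) :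
    sin (π * j / n) = sin (π * ((min j (n - j) : ℕ) / n)) := by
  obtain ⟨h1, h2⟩ := Finset.mem_Ico.1 hj
  have hn : (n : ℝ) ≠ 0 := by
    have : 0 < n := by omega
    positivity
  rcases le_total j (n - j) with h | h
  · rw [min_eq_left h, mul_div_assoc]
  · rw [min_eq_right h, ← sin_pi_sub, Nat.cast_sub h2.le]
    congr 1
    field_simp

theorem Hfun_bounds {n : ℕ} (hn₁ : 24 ≤ n) (hn₂ : n ≤ 52) :
    5225 / 10000 * (n : ℝ) < Hfun n ∧ Hfun n < 6495 / 10000 * (n : ℝ) := by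
  obtain ⟨hl, hu⟩ := sum_quarterCsc_bounds n (Finset.mem_Icc.2 ⟨hn₁, hn₂⟩)
  rw [← Nat.cast_lt (α := ℝ)] at hl hu
  push_cast at hl hu
  have key : ∀ j ∈ Finset.Ico 1 n,
      (quarterCscLower (min j (n - j)) n : ℝ) / 10 ^ 6 ≤ 1 / (4 * sin (π * j / n)) ∧
      1 / (4 * sin (π * j / n)) ≤ (quarterCscUpper (min j (n - j)) n : ℝ) / 10 ^ 6 := by
    intro j hj
    obtain ⟨h1, h2⟩ := Finset.mem_Ico.1 hj
    rw [sin_pi_mul_div_eq_min hj]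
    exact ⟨quarterCscLower_le (by omega) (by omega), le_quarterCscUpper (by omega) (by omega)⟩
  have hL := Finset.sum_le_sum fun j hj => (key j hj).1
  have hU := Finset.sum_le_sum fun j hj => (key j hj).2
  rw [← Finset.sum_div] at hL hU
  rw [Hfun]
  constructor <;> linarith

theorem sq_rpow_three_halves {y : ℝ} (hy : 0 ≤ y) : (y ^ 2) ^ ((3 : ℝ) / 2) = y ^ 3 := by
  rw [← rpow_natCast y 2, ← rpow_mul hy, ← rpow_natCast y 3]
  norm_num

/-- The determinant of the linear system (A), (B), (C) in the masses. -/
noncomputable def massDet (n H α : ℝ) : ℝ :=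
  (n * α ^ 3 / (1 + α ^ 2) ^ ((3 : ℝ) / 2) - H) * (2 - 2 / (1 + α ^ 2) ^ ((3 : ℝ) / 2)) -
    (1 / 4 - 2 / (1 + α ^ 2) ^ ((3 : ℝ) / 2)) * (n - H)

theorem continuous_massDet (n H : ℝ) : Continuous (massDet n H) := by
  have hS : Continuous fun α : ℝ => (1 + α ^ 2) ^ ((3 : ℝ) / 2) :=
    Continuous.rpow_const (by fun_prop) fun α => Or.inl (by positivity)
  have hS0 : ∀ α : ℝ, (1 + α ^ 2) ^ ((3 : ℝ) / 2) ≠ 0 := fun α => by positivity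
  unfold massDet
  fun_prop (disch := exact hS0)

theorem exists_massDet_eq_zero {n H : ℝ} (hl : 5225 / 10000 * n < H) (hu : H < 6495 / 10000 * n) :
    ∃ α : ℝ, 0 < α ∧ α < 1 ∧ 1 < 3 * α ^ 2 ∧ massDet n H α = 0 := by
  have hn : 0 < n := by linarith
  obtain ⟨r, hr0, hr⟩ : ∃ r : ℝ, 0 < r ∧ r ^ 2 = 1 / 3 :=
    ⟨√(1 / 3), by positivity, sq_sqrt (by norm_num)⟩
  have hr1 : r < 1 := by nlinarith
  have hleft : 0 < massDet n H r := by
    have hS : (1 + r ^ 2) ^ ((3 : ℝ) / 2) = 8 * r / 3 := by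
      rw [show 1 + r ^ 2 = (2 * r) ^ 2 by rw [mul_pow, hr]; norm_num,
        sq_rpow_three_halves (by positivity)]
      linear_combination 8 * r * hr
    have hr' : 57734 / 100000 < r := by nlinarith
    have hD : massDet n H r = 7 / 4 * (9 / 8 * r * n - H) := by
      rw [massDet, hS]
      field_simp
      linear_combination (192 * n * r - 576 * n) * hr
    rw [hD]
    nlinarith
  have hright : massDet n H 1 < 0 := by
    obtain ⟨q, hq0, hq⟩ : ∃ q : ℝ, 0 < q ∧ q ^ 2 = 2 := ⟨√2, by positivity, sq_sqrt (by norm_num)⟩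
    have hS : (1 + (1 : ℝ) ^ 2) ^ ((3 : ℝ) / 2) = 2 * q := by
      rw [show 1 + (1 : ℝ) ^ 2 = q ^ 2 by rw [hq]; norm_num, sq_rpow_three_halves hq0.le]
      linear_combination q * hq
    have hq' : q < 14143 / 10000 := by nlinarith
    have hD : massDet n H 1 = (q - 1 / 2) * n - 7 / 4 * H := by
      rw [massDet, hS]
      field_simp
      ring_nf
      rw [show q ^ 3 = 2 * q by rw [pow_succ, hq], hq]
      ring
    rw [hD]
    nlinarith
  obtain ⟨α, ⟨hα1, hα2⟩, hα⟩ := intermediate_value_Ioo' hr1.le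
    (continuous_massDet n H).continuousOn ⟨hright, hleft⟩
  exact ⟨α, hr0.trans hα1, hα2, by nlinarith, hα⟩

theorem exists_pos_two_mul_perturb {a b : ℝ} (ha : 0 < a) (hb : 0 < b) (x y : ℝ) :
    ∃ ε : ℝ, 0 < ε ∧ 0 < a + ε * x ∧ 0 < b + ε * y ∧ 0 < a + 2 * ε * x ∧ 0 < b + 2 * ε * y := by
  have key : ∀ {c : ℝ}, 0 < c → ∀ z k : ℝ, ∀ᶠ ε in nhdsWithin (0 : ℝ) (Set.Ioi 0),
      0 < c + k * ε * z := fun {c} hc z k => by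
    refine ((Continuous.tendsto' (f := fun ε : ℝ => c + k * ε * z) (by fun_prop) 0 c
      (by simp)).mono_left nhdsWithin_le_nhds).eventually_const_lt hc
  obtain ⟨ε, h1, h2, h3, h4, h5⟩ := (eventually_mem_nhdsWithin.and ((key ha x 1).and
    ((key hb y 1).and ((key ha x 2).and (key hb y 2))))).exists
  exact ⟨ε, h1, by simpa using h2, by simpa using h3, h4, h5⟩

/-- for `24 ≤ n ≤ 52` there are `α > 0`, `M > 0` and two distinct
positive triples `(m₀, m₁, m₂) ≠ (m₀', m₁', m₂')` both solving (A), (B), (C). -/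
theorem exists_two_mass_triples (n : ℕ) (hn₁ : 24 ≤ n) (hn₂ : n ≤ 52) :
    ∃ (α M m0 m1 m2 m0' m1' m2' : ℝ),
      0 < α ∧ 0 < M ∧
      0 < m0 ∧ 0 < m1 ∧ 0 < m2 ∧ 0 < m0' ∧ 0 < m1' ∧ 0 < m2' ∧
      (m0, m1, m2) ≠ (m0', m1', m2') ∧
      (1 = m0 + m1 * Hfun n + 2 * m2 / (1 + α ^ 2) ^ ((3 : ℝ) / 2)) ∧
      (α ^ 3 = m0 + n * α ^ 3 * m1 / (1 + α ^ 2) ^ ((3 : ℝ) / 2) + m2 / 4) ∧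
      (M = m0 + n * m1 + 2 * m2) ∧
      (1 = m0' + m1' * Hfun n + 2 * m2' / (1 + α ^ 2) ^ ((3 : ℝ) / 2)) ∧
      (α ^ 3 = m0' + n * α ^ 3 * m1' / (1 + α ^ 2) ^ ((3 : ℝ) / 2) + m2' / 4) ∧
      (M = m0' + n * m1' + 2 * m2') := by
  obtain ⟨hl, hu⟩ := Hfun_bounds hn₁ hn₂
  generalize Hfun n = H at hl hu
  obtain ⟨α, hα0, hα1, hα, hdet⟩ := exists_massDet_eq_zero hl hu
  have hSlt : (1 + α ^ 2) ^ ((3 : ℝ) / 2) < 8 * α ^ 3 := by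
    calc (1 + α ^ 2) ^ ((3 : ℝ) / 2) < ((2 * α) ^ 2) ^ ((3 : ℝ) / 2) :=
          rpow_lt_rpow (by positivity) (by linarith) (by norm_num)
      _ = 8 * α ^ 3 := by rw [sq_rpow_three_halves (by positivity)]; ring
  have hc1 : α ^ 3 < 1 := pow_lt_one₀ hα0.le hα1 (by norm_num)
  have hS0 : 0 < (1 + α ^ 2) ^ ((3 : ℝ) / 2) := by positivity
  rw [massDet] at hdet
  generalize hS : (1 + α ^ 2) ^ ((3 : ℝ) / 2) = S at hdet hSlt hS0
  have hd : 0 < 8 - S := by linarith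
  obtain ⟨a, ha⟩ : ∃ a, a = (8 * α ^ 3 - S) / (8 - S) := ⟨_, rfl⟩
  obtain ⟨b, hb⟩ : ∃ b, b = 4 * S * (1 - α ^ 3) / (8 - S) := ⟨_, rfl⟩
  obtain ⟨y, hy⟩ : ∃ y, y = 4 * (n * α ^ 3 - H * S) / (8 - S) := ⟨_, rfl⟩
  obtain ⟨x, hx⟩ : ∃ x, x = -H - 2 * y / S := ⟨_, rfl⟩
  have ha0 : 0 < a := by rw [ha]; exact div_pos (by linarith) hd
  have hb0 : 0 < b := by rw [hb]; exact div_pos (mul_pos (by positivity) (by linarith)) hd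
  have hA : 1 = a + 2 * b / S := by rw [ha, hb]; field_simp; ring
  have hB : α ^ 3 = a + b / 4 := by rw [ha, hb]; field_simp; ring
  have hxA : x + H + 2 * y / S = 0 := by rw [hx]; ring
  have hxB : x + n * α ^ 3 / S + y / 4 = 0 := by rw [hx, hy]; field_simp; ring
  have hxC : x + n + 2 * y = 0 := by
    have hyS : (2 / S - 1 / 4) * y = n * α ^ 3 / S - H := by linear_combination hxA - hxB
    have hne : 2 / S - 1 / 4 ≠ 0 := by
      rw [show 2 / S - 1 / 4 = (8 - S) / (4 * S) by field_simp; ring]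
      positivity
    refine (mul_eq_zero.1 ?_).resolve_left hne
    linear_combination hdet + (2 - 2 / S) * hyS + (2 / S - 1 / 4) * hxA
  obtain ⟨ε, hε, h1, h2, h3, h4⟩ := exists_pos_two_mul_perturb ha0 hb0 x y
  refine ⟨α, a + 2 * b, a + ε * x, ε, b + ε * y, a + 2 * ε * x, 2 * ε, b + 2 * ε * y,
    hα0, by positivity, h1, hε, h2, h3, by positivity, h4, ?_, ?_, ?_, ?_, ?_, ?_, ?_⟩
  · intro h
    simp only [Prod.mk.injEq] at h
    linarith [h.2.1]
  · rw [hS]; linear_combination hA - ε * hxA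
  · rw [hS]; linear_combination hB - ε * hxB
  · linear_combination -ε * hxC
  · rw [hS]; linear_combination hA - 2 * ε * hxA
  · rw [hS]; linear_combination hB - 2 * ε * hxB
  · linear_combination -2 * ε * hxC
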